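/- arXiv:1804.03469 — 2 statements merged into one kernel-verified Lean document; each statement's English description precedes it below -/
import Mathlib

section
/- For every 1 ≤ p < ∞, the Banach spaces L_p + L_∞ on (0, ∞) and L_p ∩ L_∞ on (0, ∞) are not isomorphic. -/
open MeasureTheory ENNReal

noncomputable section

/-- Lebesgue measure on the half-line `(0, ∞)`. -/
def m0 : MeasureTheory.Measure ℝ := MeasureTheory.volume.restrict (Set.Ioi 0)

/-- The space `L_p + L_q` on `(0, ∞)`, realized as the submodule of (a.e.-equivalence classes
of) measurable functions that are sums of an `L_p` and an `L_q` function. -/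
def sumSpace (p q : ℝ≥0∞) : Submodule ℝ (ℝ →ₘ[m0] ℝ) :=
  Lp.LpSubmodule ℝ ℝ p m0 ⊔ Lp.LpSubmodule ℝ ℝ q m0

/-- The space `L_p ∩ L_q` on `(0, ∞)`, realized as the submodule of (a.e.-equivalence classes
of) measurable functions that belong to both `L_p` and `L_q`. -/
def interSpace (p q : ℝ≥0∞) : Submodule ℝ (ℝ →ₘ[m0] ℝ) :=
  Lp.LpSubmodule ℝ ℝ p m0 ⊓ Lp.LpSubmodule ℝ ℝ q m0

/-- The natural norm on `L_p + L_q`:  `‖f‖ = inf { ‖u‖_p + ‖v‖_q : f = u + v }`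
(with value `∞` outside of the space). -/
def sumNormE (p q : ℝ≥0∞) (f : ℝ →ₘ[m0] ℝ) : ℝ≥0∞ :=
  ⨅ (u : Lp ℝ p m0) (v : Lp ℝ q m0)
    (_ : f = (u : ℝ →ₘ[m0] ℝ) + (v : ℝ →ₘ[m0] ℝ)),
      eLpNorm (u : ℝ → ℝ) p m0 + eLpNorm (v : ℝ → ℝ) q m0

/-- The natural norm on `L_p ∩ L_q`:  `‖f‖ = max (‖f‖_p, ‖f‖_q)`. -/
def interNormE (p q : ℝ≥0∞) (f : ℝ →ₘ[m0] ℝ) : ℝ≥0∞ :=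
  max (eLpNorm (f : ℝ → ℝ) p m0) (eLpNorm (f : ℝ → ℝ) q m0)

/-- `L_p + L_q` and `L_p ∩ L_q` are isomorphic as Banach spaces: there is a linear bijection
between them which, together with its inverse, is bounded. -/
def SumInterIsomorphic (p q : ℝ≥0∞) : Prop :=
  ∃ T : sumSpace p q ≃ₗ[ℝ] interSpace p q, ∃ C : ℝ≥0∞, 0 < C ∧ C < ∞ ∧
    ∀ f : sumSpace p q,
      interNormE p q ((T f : ℝ →ₘ[m0] ℝ)) ≤ C * sumNormE p q (f : ℝ →ₘ[m0] ℝ) ∧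
      sumNormE p q (f : ℝ →ₘ[m0] ℝ) ≤ C * interNormE p q ((T f : ℝ →ₘ[m0] ℝ))


def sg (A : Finset ℕ) (i : ℕ) : ℝ := if i ∈ A then 1 else -1

lemma sg_sq (A : Finset ℕ) (i : ℕ) : sg A i ^ 2 = 1 := by
  unfold sg; split_ifs <;> norm_num

lemma abs_sg (A : Finset ℕ) (i : ℕ) : |sg A i| = 1 := by
  unfold sg; split_ifs <;> norm_num

/-- Averaging over signs: adding one index. -/
lemma sum_sg_succ (K : ℕ) (a : ℕ → ℝ) (G : ℝ → ℝ) :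
    ∑ A ∈ (Finset.range (K+1)).powerset, G (∑ i ∈ Finset.range (K+1), sg A i * a i)
    = ∑ A ∈ (Finset.range K).powerset,
      (G (∑ i ∈ Finset.range K, sg A i * a i - a K)
        + G (∑ i ∈ Finset.range K, sg A i * a i + a K)) := by
  have hr : Finset.range (K+1) = insert K (Finset.range K) := Finset.range_add_one
  rw [hr, Finset.sum_powerset_insert (by simp), ← Finset.sum_add_distrib]
  refine Finset.sum_congr rfl fun A hA => ?_
  have hK : K ∉ A := fun h => by
    have := Finset.mem_powerset.1 hA h
    simp at this
  rw [Finset.sum_insert (by simp), Finset.sum_insert (by simp)]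
  have h1 : ∑ i ∈ Finset.range K, sg (insert K A) i * a i
      = ∑ i ∈ Finset.range K, sg A i * a i := by
    refine Finset.sum_congr rfl fun i hi => ?_
    have : i ≠ K := by have := Finset.mem_range.1 hi; omega
    simp [sg, this]
  rw [h1]
  have e1 : sg A K = -1 := by simp [sg, hK]
  have e2 : sg (insert K A) K = 1 := by simp [sg]
  rw [e1, e2]
  congr 2 <;> ring

lemma sg_mom2 (K : ℕ) (a : ℕ → ℝ) :
    ∑ A ∈ (Finset.range K).powerset, (∑ i ∈ Finset.range K, sg A i * a i)^2
      = 2^K * ∑ i ∈ Finset.range K, a i ^ 2 := by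
  induction K with
  | zero => simp
  | succ K ih =>
    rw [sum_sg_succ K a (fun x => x^2), Finset.sum_range_succ]
    have : ∀ A ∈ (Finset.range K).powerset, ((∑ i ∈ Finset.range K, sg A i * a i - a K)^2
        + (∑ i ∈ Finset.range K, sg A i * a i + a K)^2)
        = 2 * (∑ i ∈ Finset.range K, sg A i * a i)^2 + 2 * (a K)^2 := fun A _ => by ring
    rw [Finset.sum_congr rfl this, Finset.sum_add_distrib, ← Finset.mul_sum, ih]
    simp [Finset.card_powerset]
    ring

lemma sg_mom4 (K : ℕ) (a : ℕ → ℝ) :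
    ∑ A ∈ (Finset.range K).powerset, (∑ i ∈ Finset.range K, sg A i * a i)^4
      ≤ 3 * 2^K * (∑ i ∈ Finset.range K, a i ^ 2)^2 := by
  induction K with
  | zero => simp
  | succ K ih =>
    rw [sum_sg_succ K a (fun x => x^4), Finset.sum_range_succ]
    have : ∀ A ∈ (Finset.range K).powerset, ((∑ i ∈ Finset.range K, sg A i * a i - a K)^4
        + (∑ i ∈ Finset.range K, sg A i * a i + a K)^4)
        = 2 * (∑ i ∈ Finset.range K, sg A i * a i)^4
          + 12 * (a K)^2 * (∑ i ∈ Finset.range K, sg A i * a i)^2 + 2 * (a K)^4 :=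
      fun A _ => by ring
    rw [Finset.sum_congr rfl this, Finset.sum_add_distrib, Finset.sum_add_distrib,
      ← Finset.mul_sum, ← Finset.mul_sum, sg_mom2]
    simp only [Finset.sum_const, Finset.card_powerset, Finset.card_range, nsmul_eq_mul]
    push_cast
    set σ := ∑ i ∈ Finset.range K, a i ^ 2
    have : (0:ℝ) ≤ 2^K * (a K)^4 := by positivity
    have e : (2:ℝ)^(K+1) = 2 * 2^K := by ring
    rw [e]
    nlinarith [ih]

lemma quartic (x σ : ℝ) (hx : 0 ≤ x) (hσ : 0 < σ) :
    x^2 * σ⁻¹ - x^4 * (σ⁻¹)^3 / 6 ≤ x := by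
  have ht : 0 ≤ x * σ⁻¹ := by positivity
  have key : ∀ t : ℝ, 0 ≤ t → t^2 - t^4/6 ≤ t := by
    intro t ht
    have h2 : Real.sqrt 2 ^ 2 = 2 := Real.sq_sqrt (by norm_num)
    have h3 : Real.sqrt 2 ≤ 3/2 := by
      rw [Real.sqrt_le_left (by norm_num)]; norm_num
    have h0 : 0 ≤ Real.sqrt 2 := Real.sqrt_nonneg 2
    have h : 0 ≤ (t - Real.sqrt 2)^2 * (t + 2 * Real.sqrt 2) := by positivity
    have e : (t - Real.sqrt 2)^2 * (t + 2 * Real.sqrt 2) = t^3 - 3 * t * Real.sqrt 2^2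
       + 2 * Real.sqrt 2 * Real.sqrt 2^2 := by ring
    rw [e, h2] at h
    have : 0 ≤ t^3 - 6 * t + 6 := by linarith
    nlinarith [mul_nonneg ht this]
  have h := mul_le_mul_of_nonneg_left (key _ ht) hσ.le
  have e : σ * ((x*σ⁻¹)^2 - (x*σ⁻¹)^4/6) = x^2 * σ⁻¹ - x^4 * (σ⁻¹)^3 / 6 := by
    field_simp
  have e2 : σ * (x * σ⁻¹) = x := by field_simp
  rw [e, e2] at h
  exact h

lemma khintchine (K : ℕ) (a : ℕ → ℝ) :
    2^K * (Real.sqrt (∑ i ∈ Finset.range K, a i ^ 2) / 2)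
      ≤ ∑ A ∈ (Finset.range K).powerset, |∑ i ∈ Finset.range K, sg A i * a i| := by
  set σ := Real.sqrt (∑ i ∈ Finset.range K, a i ^ 2) with hσ
  have h0 : 0 ≤ ∑ i ∈ Finset.range K, a i ^ 2 := Finset.sum_nonneg fun i _ => sq_nonneg _
  have hs : σ^2 = ∑ i ∈ Finset.range K, a i ^ 2 := Real.sq_sqrt h0
  rcases (Real.sqrt_nonneg _ : 0 ≤ σ).eq_or_lt with h | h
  · have h' : σ = 0 := h.symm
    rw [h']; simp only [zero_div, mul_zero]
    exact Finset.sum_nonneg fun i _ => abs_nonneg _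
  have := Finset.sum_le_sum (s := (Finset.range K).powerset) fun A _ =>
    quartic |∑ i ∈ Finset.range K, sg A i * a i| σ (abs_nonneg _) h
  refine le_trans ?_ this
  have e4 : ∀ x : ℝ, |x|^4 = x^4 := fun x => by
    rw [← abs_pow, abs_of_nonneg (by positivity)]
  simp only [sq_abs, e4]
  rw [Finset.sum_sub_distrib, ← Finset.sum_mul, sg_mom2, ← Finset.sum_div, ← Finset.sum_mul, ← hs]
  have m4 := sg_mom4 K a
  rw [← hs] at m4
  have := mul_le_mul_of_nonneg_right m4 (by positivity : 0 ≤ (σ⁻¹)^3)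
  have e1 : 3 * 2 ^ K * (σ ^ 2) ^ 2 * σ⁻¹ ^ 3 = 3 * 2^K * σ := by field_simp
  have e2 : 2 ^ K * σ ^ 2 * σ⁻¹ = 2^K * σ := by field_simp
  rw [e1] at this
  rw [e2]
  linarith

lemma khintchine_p (r : ℝ) (hr : 1 ≤ r) (K : ℕ) (a : ℕ → ℝ) :
    2^K * (Real.sqrt (∑ i ∈ Finset.range K, a i ^ 2) / 2)^r
      ≤ ∑ A ∈ (Finset.range K).powerset, |∑ i ∈ Finset.range K, sg A i * a i|^r := by
  have hk := khintchine K a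
  set σ := Real.sqrt (∑ i ∈ Finset.range K, a i ^ 2)
  have h2 : (0:ℝ) < 2^K := by positivity
  have hσ : 0 ≤ σ := Real.sqrt_nonneg _
  have j := Real.rpow_arith_mean_le_arith_mean_rpow (Finset.range K).powerset
    (fun _ => ((2:ℝ)^K)⁻¹) (fun A => |∑ i ∈ Finset.range K, sg A i * a i|)
    (fun _ _ => by positivity) (by simp [Finset.card_powerset]) (fun _ _ => abs_nonneg _) hr
  rw [← Finset.mul_sum, ← Finset.mul_sum] at j
  have : σ / 2 ≤ ((2:ℝ)^K)⁻¹ * ∑ A ∈ (Finset.range K).powerset,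
      |∑ i ∈ Finset.range K, sg A i * a i| := by
    rw [inv_mul_eq_div, le_div_iff₀ h2]; linarith
  have h := (Real.rpow_le_rpow (by positivity) this (by linarith)).trans j
  rw [inv_mul_eq_div, le_div_iff₀ h2] at h
  linarith

lemma sum_rpow_le (r : ℝ) (hr : 1 ≤ r) : ∃ β : ℝ, β < 1 ∧ ∀ (K : ℕ) (a : ℕ → ℝ),
    ∑ i ∈ Finset.range K, |a i|^r
      ≤ (K:ℝ)^β * (Real.sqrt (∑ i ∈ Finset.range K, a i ^ 2))^r := by
  have hle : ∀ (K : ℕ) (b : ℕ → ℝ) (s : ℝ), 1 ≤ s → (∀ i, 0 ≤ b i) →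
      ∑ i ∈ Finset.range K, (b i)^s ≤ (∑ i ∈ Finset.range K, b i)^s := by
    intro K b s hs hb
    induction K with
    | zero => simp [Real.zero_rpow (by linarith : s ≠ 0)]
    | succ K ih =>
      rw [Finset.sum_range_succ, Finset.sum_range_succ]
      refine le_trans (add_le_add_left ih _) ?_
      exact Real.add_rpow_le_rpow_add (Finset.sum_nonneg fun i _ => hb i) (hb K) hs
  by_cases h2 : r < 2
  · refine ⟨r/2, by linarith, fun K a => ?_⟩
    refine (hle K (fun i => |a i|) r hr (fun i => abs_nonneg _)).trans ?_
    have : ∑ i ∈ Finset.range K, |a i| ≤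
        Real.sqrt K * Real.sqrt (∑ i ∈ Finset.range K, a i ^ 2) := by
      rw [← Real.sqrt_mul (by positivity)]
      apply Real.le_sqrt_of_sq_le
      have := sq_sum_le_card_mul_sum_sq (s := Finset.range K) (f := fun i => |a i|)
      simpa using this
    refine (Real.rpow_le_rpow (Finset.sum_nonneg fun i _ => abs_nonneg _) this
      (by linarith)).trans ?_
    rw [Real.mul_rpow (by positivity) (by positivity), Real.sqrt_eq_rpow (K:ℝ),
      ← Real.rpow_mul (by positivity)]
    apply le_of_eq
    congr 2; ring
  · refine ⟨0, by norm_num, fun K a => ?_⟩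
    have := hle K (fun i => (a i)^2) (r/2) (by linarith) (fun i => sq_nonneg _)
    have h0 : 0 ≤ ∑ i ∈ Finset.range K, a i ^ 2 := Finset.sum_nonneg fun i _ => sq_nonneg _
    rw [Real.rpow_zero, one_mul, Real.sqrt_eq_rpow, ← Real.rpow_mul h0]
    rw [show 1/2*r = r/2 by ring]
    refine le_trans (le_of_eq ?_) this
    refine Finset.sum_congr rfl fun i _ => ?_
    rw [← sq_abs, ← Real.rpow_natCast, ← Real.rpow_mul (abs_nonneg _)]
    congr 1; push_cast; ring

lemma cotype_pt (r : ℝ) (hr : 1 ≤ r) : ∃ β : ℝ, β < 1 ∧ ∀ (K : ℕ) (a : ℕ → ℝ),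
    2^K * ∑ i ∈ Finset.range K, |a i|^r
      ≤ (2^r * (K:ℝ)^β) *
        ∑ A ∈ (Finset.range K).powerset, |∑ i ∈ Finset.range K, sg A i * a i|^r := by
  obtain ⟨β, hβ, h⟩ := sum_rpow_le r hr
  refine ⟨β, hβ, fun K a => ?_⟩
  have h1 := khintchine_p r hr K a
  have h2 := h K a
  set σ := Real.sqrt (∑ i ∈ Finset.range K, a i ^ 2)
  have hσ : 0 ≤ σ := Real.sqrt_nonneg _
  rw [Real.div_rpow hσ (by norm_num)] at h1
  have h3 : (0:ℝ) < 2^r := by positivity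
  calc _ ≤ 2^K * ((K:ℝ)^β * σ^r) := by gcongr
    _ = (2^r * (K:ℝ)^β) * (2^K * (σ^r / 2^r)) := by field_simp
    _ ≤ _ := by gcongr

lemma cotype (p : ℝ≥0∞) (hp : 1 ≤ p) (hp' : p ≠ ∞) (B η : ℝ≥0∞) (hB : B ≠ ∞) (hη : η ≠ 0) :
    ∃ K : ℕ, 0 < K ∧ ∀ (μ : Measure ℝ) (f : ℕ → ℝ → ℝ), (∀ i, AEStronglyMeasurable (f i) μ) →
      (∀ A : Finset ℕ, eLpNorm (fun t => ∑ i ∈ Finset.range K, sg A i * f i t) p μ ≤ B) →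
      ∃ i < K, eLpNorm (f i) p μ < η := by
  wlog hη' : η ≠ ∞ generalizing η
  · obtain ⟨K, hK, h⟩ := this 1 (by simp) (by simp)
    refine ⟨K, hK, fun μ f hf hA => ?_⟩
    obtain ⟨i, hi, h⟩ := h μ f hf hA
    refine ⟨i, hi, h.trans_le ?_⟩
    push Not at hη'; simp [hη']
  set r := p.toReal with hr
  have hr1 : 1 ≤ r := by
    rw [hr, ← ENNReal.toReal_one]; exact ENNReal.toReal_mono hp' hp
  have hp0 : p ≠ 0 := by rintro rfl; simp at hp
  obtain ⟨β, hβ, h⟩ := cotype_pt r hr1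
  -- choose K
  have hK : ∃ K : ℕ, 0 < K ∧ 2^r * (K:ℝ)^β * (B.toReal)^r < K * (η.toReal)^r := by
    have hpos : 0 < η.toReal ^ r := Real.rpow_pos_of_pos (ENNReal.toReal_pos hη hη') _
    have ht : Filter.Tendsto (fun K : ℕ => (K:ℝ)^(1-β)) Filter.atTop Filter.atTop :=
      (tendsto_rpow_atTop (by linarith)).comp tendsto_natCast_atTop_atTop
    obtain ⟨K, hK1, hK2⟩ := ((ht.eventually_gt_atTop (2^r * B.toReal^r / η.toReal^r)).and
      (Filter.eventually_gt_atTop 0)).exists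
    refine ⟨K, hK2, ?_⟩
    have hKpos : (0:ℝ) < K := by exact_mod_cast hK2
    rw [div_lt_iff₀ hpos] at hK1
    have : (K:ℝ) = (K:ℝ)^β * (K:ℝ)^(1-β) := by
      rw [← Real.rpow_add hKpos]; simp
    calc 2^r * (K:ℝ)^β * (B.toReal)^r = (K:ℝ)^β * (2^r * B.toReal^r) := by ring
      _ < (K:ℝ)^β * ((K:ℝ)^(1-β) * η.toReal^r) := by gcongr
      _ = _ := by rw [← mul_assoc, ← this]
  obtain ⟨K, hK0, hK⟩ := hK
  refine ⟨K, hK0, fun μ f hf hA => ?_⟩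
  by_contra! hcon
  have hI : ∀ g : ℝ → ℝ, ∫⁻ t, ENNReal.ofReal (|g t|^r) ∂μ = eLpNorm g p μ ^ r := by
    intro g
    rw [eLpNorm_eq_lintegral_rpow_enorm_toReal hp0 hp', ← hr, ← ENNReal.rpow_mul,
      one_div, inv_mul_cancel₀ (by linarith), ENNReal.rpow_one]
    refine lintegral_congr fun t => ?_
    rw [← ENNReal.ofReal_rpow_of_nonneg (abs_nonneg _) (by linarith), Real.enorm_eq_ofReal_abs]
  have hm : ∀ g : ℝ → ℝ, AEStronglyMeasurable g μ →
      AEMeasurable (fun t => ENNReal.ofReal (|g t|^r)) μ := by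
    intro g hg
    have := hg.aemeasurable
    fun_prop
  have key : ∫⁻ t, 2^K * ∑ i ∈ Finset.range K, ENNReal.ofReal (|f i t|^r) ∂μ
     ≤ ∫⁻ t, ENNReal.ofReal (2^r * (K:ℝ)^β) * ∑ A ∈ (Finset.range K).powerset,
        ENNReal.ofReal (|∑ i ∈ Finset.range K, sg A i * f i t|^r) ∂μ := by
    refine lintegral_mono fun t => ?_
    have := ENNReal.ofReal_le_ofReal (h K (fun i => f i t))
    rw [ENNReal.ofReal_mul (by positivity), ENNReal.ofReal_mul (by positivity),
      ENNReal.ofReal_sum_of_nonneg (fun i _ => by positivity),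
      ENNReal.ofReal_sum_of_nonneg (fun i _ => by positivity)] at this
    simpa using this
  rw [lintegral_const_mul'' _ (by
      refine Finset.aemeasurable_fun_sum _ fun i _ => hm _ (hf i)),
    lintegral_const_mul' _ _ ENNReal.ofReal_ne_top,
    lintegral_finsetSum' _ (fun i _ => hm _ (hf i)),
    lintegral_finsetSum' _ (fun A _ => hm _ (by
      exact Finset.aestronglyMeasurable_fun_sum _ fun i _ => (hf i).const_mul _))] at key
  simp only [hI] at key
  have low : 2^K * ((K:ℝ≥0∞) * η^r) ≤
      2^K * ∑ i ∈ Finset.range K, eLpNorm (f i) p μ ^ r := by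
    gcongr
    calc (K:ℝ≥0∞) * η^r = ∑ i ∈ Finset.range K, η^r := by simp
      _ ≤ _ := Finset.sum_le_sum fun i hi =>
        ENNReal.rpow_le_rpow (hcon i (Finset.mem_range.1 hi)) (by linarith)
  have upp : ∑ A ∈ (Finset.range K).powerset,
      eLpNorm (fun t => ∑ i ∈ Finset.range K, sg A i * f i t) p μ ^ r ≤ 2^K * B^r := by
    calc _ ≤ ∑ A ∈ (Finset.range K).powerset, B^r := Finset.sum_le_sum fun A _ =>
          ENNReal.rpow_le_rpow (hA A) (by linarith)
      _ = _ := by simp [Finset.card_powerset]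
  have fin := (low.trans key).trans (mul_le_mul_right upp (ENNReal.ofReal (2^r * (K:ℝ)^β)))
  have fin' := ENNReal.toReal_mono (by finiteness) fin
  simp only [ENNReal.toReal_mul, ENNReal.toReal_pow, ENNReal.toReal_natCast,
    ← ENNReal.toReal_rpow, ENNReal.toReal_ofReal (by positivity : 0 ≤ 2^r * (K:ℝ)^β)] at fin'
  have h2 : (0:ℝ) < 2^K := by positivity
  have e : (ENNReal.toReal 2) = 2 := by simp
  rw [e] at fin'
  nlinarith

/-- The interval `(k, k+1]`. -/
def Ik (k : ℕ) : Set ℝ := Set.Ioc (k:ℝ) (k+1)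

lemma Ik_meas (k : ℕ) : MeasurableSet (Ik k) := measurableSet_Ioc

/-- Probability measure on `(k, k+1]`. -/
def nuk (k : ℕ) : Measure ℝ := m0.restrict (Ik k)

lemma nuk_eq (k : ℕ) : nuk k = volume.restrict (Ik k) := by
  unfold nuk m0
  rw [Measure.restrict_restrict (Ik_meas k)]
  congr 1
  apply Set.inter_eq_left.2
  intro t ht
  have h1 : (k:ℝ) < t := ht.1
  have : (0:ℝ) ≤ k := by positivity
  exact lt_of_le_of_lt this h1

instance (k : ℕ) : IsProbabilityMeasure (nuk k) := by
  constructor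
  rw [nuk_eq]
  simp [Ik]

/-- The basic functions. -/
def cf (k n : ℕ) : ℝ → ℝ := (Ik k).indicator (fun t => Real.cos (2 * Real.pi * (n+1) * t))

lemma cf_meas (k n : ℕ) : Measurable (cf k n) := by
  unfold cf
  exact Measurable.indicator (by fun_prop) (Ik_meas k)

lemma cf_le (k n : ℕ) (t : ℝ) : |cf k n t| ≤ 1 := by
  unfold cf
  by_cases h : t ∈ Ik k
  · simp [h, Real.abs_cos_le_one]
  · simp [h]

lemma Ik_unique {k l : ℕ} {t : ℝ} (hk : t ∈ Ik k) (hl : t ∈ Ik l) : k = l := by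
  have h1 : (k:ℝ) < l + 1 := lt_of_lt_of_le hk.1 hl.2
  have h2 : (l:ℝ) < k + 1 := lt_of_lt_of_le hl.1 hk.2
  norm_cast at h1 h2
  omega

lemma cf_diag_le (K : ℕ) (n : ℕ → ℕ) (θ : ℕ → ℝ) (hθ : ∀ i, |θ i| = 1) (t : ℝ) :
    |∑ k ∈ Finset.range K, θ k * cf k (n k) t| ≤ 1 := by
  by_cases h : ∃ k ∈ Finset.range K, t ∈ Ik k
  · obtain ⟨k, hk, ht⟩ := h
    rw [Finset.sum_eq_single k]
    · rw [abs_mul, hθ, one_mul]; exact cf_le _ _ _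
    · intro l _ hl
      have : t ∉ Ik l := fun h => hl (Ik_unique h ht)
      simp [cf, this]
    · intro h; exact absurd hk h
  · push Not at h
    rw [Finset.sum_eq_zero]
    · simp
    · intro k hk
      simp [cf, h k hk]

lemma int_cos (j : ℤ) (hj : j ≠ 0) (k : ℕ) :
    ∫ t in (k:ℝ)..(k+1), Real.cos (2 * Real.pi * j * t) = 0 := by
  have hj' : (2 * Real.pi * j : ℝ) ≠ 0 := by
    have : (j:ℝ) ≠ 0 := by exact_mod_cast hj
    have := Real.pi_pos.ne'
    positivity
  rw [intervalIntegral.integral_comp_mul_left (fun x => Real.cos x) hj', integral_cos]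
  have h1 : Real.sin (2 * Real.pi * j * (k+1)) = 0 := by
    rw [Real.sin_eq_zero_iff]; refine ⟨2 * j * (k+1), ?_⟩; push_cast; ring
  have h2 : Real.sin (2 * Real.pi * j * k) = 0 := by
    rw [Real.sin_eq_zero_iff]; refine ⟨2 * j * k, ?_⟩; push_cast; ring
  rw [h1, h2]; simp

lemma int_cos_cos (n m k : ℕ) :
    ∫ t in (k:ℝ)..(k+1), Real.cos (2 * Real.pi * (n+1) * t) * Real.cos (2 * Real.pi * (m+1) * t)
      = if n = m then 1/2 else 0 := by
  have e : ∀ t : ℝ, Real.cos (2 * Real.pi * (n+1) * t) * Real.cos (2 * Real.pi * (m+1) * t)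
      = 1/2 * (Real.cos (2 * Real.pi * ((n - m : ℤ) : ℝ) * t)
        + Real.cos (2 * Real.pi * ((n + m + 2 : ℤ) : ℝ) * t)) := by
    intro t
    have h1 : 2 * Real.pi * ((n - m : ℤ) : ℝ) * t
      = 2 * Real.pi * (n+1) * t - 2 * Real.pi * (m+1) * t := by push_cast; ring
    have h2 : 2 * Real.pi * ((n + m + 2 : ℤ) : ℝ) * t
      = 2 * Real.pi * (n+1) * t + 2 * Real.pi * (m+1) * t := by push_cast; ring
    rw [h1, h2, Real.cos_add, Real.cos_sub]; ring
  simp_rw [e]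
  rw [intervalIntegral.integral_const_mul, intervalIntegral.integral_add
    (Continuous.intervalIntegrable (by fun_prop) _ _)
    (Continuous.intervalIntegrable (by fun_prop) _ _), int_cos (n+m+2) (by omega)]
  split_ifs with h
  · subst h; simp
  · rw [int_cos _ (by omega)]; simp

lemma int_sq (k : ℕ) (S : Finset ℕ) :
    ∫ t in (k:ℝ)..(k+1), (∑ n ∈ S, Real.cos (2 * Real.pi * (n+1) * t))^2 = S.card / 2 := by
  simp_rw [sq, Finset.sum_mul_sum]
  rw [intervalIntegral.integral_finsetSum
    (fun i _ => Continuous.intervalIntegrable (by fun_prop) _ _)]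
  have : ∀ n ∈ S, ∫ t in (k:ℝ)..(k+1), ∑ m ∈ S,
      Real.cos (2 * Real.pi * (n+1) * t) * Real.cos (2 * Real.pi * (m+1) * t) = 1/2 := by
    intro n hn
    rw [intervalIntegral.integral_finsetSum
      (fun i _ => Continuous.intervalIntegrable (by fun_prop) _ _)]
    simp_rw [int_cos_cos]
    simp [hn]
  rw [Finset.sum_congr rfl this]
  simp; ring

lemma lint_sq (k : ℕ) (S : Finset ℕ) :
    ∫⁻ t, ENNReal.ofReal ((∑ n ∈ S, Real.cos (2 * Real.pi * (n+1) * t))^2) ∂(nuk k)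
      = ENNReal.ofReal (S.card / 2) := by
  rw [← ofReal_integral_eq_lintegral_ofReal, ← int_sq k S,
    intervalIntegral.integral_of_le (by linarith), nuk_eq]
  · rfl
  · rw [nuk_eq]
    exact (Continuous.integrableOn_Ioc (by fun_prop))
  · exact Filter.Eventually.of_forall fun t => sq_nonneg _

lemma cf_ae (k n : ℕ) :
    cf k n =ᵐ[nuk k] fun t => Real.cos (2 * Real.pi * (n+1) * t) := by
  filter_upwards [ae_restrict_mem (μ := m0) (Ik_meas k)] with t ht
  simp [cf, ht]

lemma cf_low (p : ℝ≥0∞) (hp : 1 ≤ p) (k n : ℕ) : 1/2 ≤ eLpNorm (cf k n) p (nuk k) := by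
  refine le_trans ?_ (eLpNorm_le_eLpNorm_of_exponent_le hp (cf_meas k n).aestronglyMeasurable)
  rw [eLpNorm_congr_ae (cf_ae k n), eLpNorm_one_eq_lintegral_enorm]
  have := lint_sq k {n}
  simp only [Finset.sum_singleton, Finset.card_singleton, Nat.cast_one] at this
  have e : ENNReal.ofReal (1/2) = 1/2 := by
    rw [ENNReal.ofReal_div_of_pos (by norm_num)]; simp
  rw [e] at this
  rw [← this]
  refine lintegral_mono fun t => ?_
  rw [Real.enorm_eq_ofReal_abs]
  refine ENNReal.ofReal_le_ofReal ?_
  rw [← sq_abs]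
  have := Real.abs_cos_le_one (2 * Real.pi * (n+1) * t)
  have := abs_nonneg (Real.cos (2 * Real.pi * (n+1) * t))
  nlinarith

lemma cf_upp (p : ℝ≥0∞) (hp' : p ≠ ∞) : ∃ α : ℝ, α < 1 ∧ 0 ≤ α ∧
    ∀ (k : ℕ) (S : Finset ℕ),
      eLpNorm (fun t => ∑ n ∈ S, cf k n t) p m0 ≤ ENNReal.ofReal ((S.card : ℝ)^α) := by
  set q : ℝ := max p.toReal 2 with hq
  have hq2 : 2 ≤ q := le_max_right _ _
  have hpq : p ≤ ENNReal.ofReal q :=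
    ENNReal.le_ofReal_iff_toReal_le hp' (by linarith) |>.2 (le_max_left _ _)
  have hinv : 1/q ≤ 1/2 := by gcongr
  have hinv0 : 0 < 1/q := by positivity
  refine ⟨1 - 1/q, by linarith, by linarith, fun k S => ?_⟩
  have hind : (fun t => ∑ n ∈ S, cf k n t) =
      (Ik k).indicator (fun t => ∑ n ∈ S, Real.cos (2 * Real.pi * (n+1) * t)) := by
    ext t
    by_cases h : t ∈ Ik k <;> simp [cf, h]
  rw [hind, eLpNorm_indicator_eq_eLpNorm_restrict (Ik_meas k)]
  change eLpNorm _ p (nuk k) ≤ _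
  have hcont : Continuous (fun t => ∑ n ∈ S, Real.cos (2 * Real.pi * ((n:ℕ)+1) * t)) := by
    fun_prop
  refine (eLpNorm_le_eLpNorm_of_exponent_le hpq hcont.aestronglyMeasurable).trans ?_
  rw [eLpNorm_eq_lintegral_rpow_enorm_toReal (by simp; linarith) (by simp),
    ENNReal.toReal_ofReal (by linarith)]
  rcases S.eq_empty_or_nonempty with rfl | hS
  · have : 1 - 1/q ≠ 0 := by linarith
    have h0 : (0:ℝ) < q := by linarith
    simp [h0, ENNReal.zero_rpow_of_pos]
  have hc : (0:ℝ) < S.card := by exact_mod_cast hS.card_pos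
  have hle : ∫⁻ t, ‖∑ n ∈ S, Real.cos (2 * Real.pi * ((n:ℕ)+1) * t)‖ₑ^q ∂(nuk k)
      ≤ ENNReal.ofReal ((S.card:ℝ)^(q-1)) := by
    calc _ ≤ ∫⁻ t, ENNReal.ofReal ((S.card:ℝ)^(q-2)) *
          ENNReal.ofReal ((∑ n ∈ S, Real.cos (2 * Real.pi * (n+1) * t))^2) ∂(nuk k) := by
          refine lintegral_mono fun t => ?_
          set x := ∑ n ∈ S, Real.cos (2 * Real.pi * ((n:ℕ)+1) * t) with hx
          have hxb : |x| ≤ S.card := by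
            refine (Finset.abs_sum_le_sum_abs _ _).trans ?_
            refine (Finset.sum_le_sum fun n _ => Real.abs_cos_le_one _).trans ?_
            simp
          simp only
          rw [← ENNReal.ofReal_mul (by positivity), Real.enorm_eq_ofReal_abs,
            ENNReal.ofReal_rpow_of_nonneg (abs_nonneg _) (by linarith)]
          refine ENNReal.ofReal_le_ofReal ?_
          rw [← sq_abs x]
          have : |x|^q = |x|^(q-2) * |x|^2 := by
            rw [← Real.rpow_natCast, ← Real.rpow_add' (abs_nonneg _) (by push_cast; linarith)]
            congr 1; push_cast; ring
          rw [this]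
          gcongr
      _ = ENNReal.ofReal ((S.card:ℝ)^(q-2)) * ENNReal.ofReal (S.card / 2) := by
          rw [lintegral_const_mul' _ _ ENNReal.ofReal_ne_top, lint_sq]
      _ ≤ _ := by
          rw [← ENNReal.ofReal_mul (by positivity)]
          refine ENNReal.ofReal_le_ofReal ?_
          have : (S.card:ℝ)^(q-1) = (S.card:ℝ)^(q-2) * S.card := by
            rw [← Real.rpow_add_one hc.ne']; congr 1; ring
          rw [this]
          gcongr
          linarith
  refine (ENNReal.rpow_le_rpow hle (by positivity)).trans ?_
  rw [ENNReal.ofReal_rpow_of_nonneg (by positivity) (by positivity), ← Real.rpow_mul hc.le]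
  apply le_of_eq
  congr 2
  field_simp

lemma lc_coe (S : Finset ℕ) (θ : ℕ → ℝ) (F : ℕ → (ℝ →ₘ[m0] ℝ)) :
    ⇑(∑ i ∈ S, θ i • F i) =ᵐ[m0] fun t => ∑ i ∈ S, θ i * F i t := by
  refine (AEEqFun.coeFn_fun_finsetSum S (fun i => θ i • F i)).trans ?_
  have : ∀ᵐ t ∂m0, ∀ i, (θ i • F i : ℝ →ₘ[m0] ℝ) t = θ i * F i t :=
    ae_all_iff.2 fun i => by
      filter_upwards [AEEqFun.coeFn_smul (θ i) (F i)] with t ht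
      simpa using ht
  filter_upwards [this] with t ht
  exact Finset.sum_congr rfl fun i _ => ht i

lemma sumNormE_le_top (p : ℝ≥0∞) (f : ℝ →ₘ[m0] ℝ) : sumNormE p ∞ f ≤ eLpNorm f ∞ m0 := by
  by_cases h : eLpNorm f ∞ m0 = ∞
  · rw [h]; exact le_top
  unfold sumNormE
  refine (iInf_le _ 0).trans ((iInf_le _ ⟨f, Lp.mem_Lp_iff_eLpNorm_lt_top.2 (lt_top_iff_ne_top.2 h)⟩).trans
    ((iInf_le _ (by simp)).trans ?_))
  rw [eLpNorm_congr_ae (Lp.coeFn_zero ℝ p m0)]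
  simp

lemma sumNormE_le_p (p : ℝ≥0∞) (f : ℝ →ₘ[m0] ℝ) : sumNormE p ∞ f ≤ eLpNorm f p m0 := by
  by_cases h : eLpNorm f p m0 = ∞
  · rw [h]; exact le_top
  unfold sumNormE
  refine (iInf_le _ ⟨f, Lp.mem_Lp_iff_eLpNorm_lt_top.2 (lt_top_iff_ne_top.2 h)⟩).trans ((iInf_le _ 0).trans
    ((iInf_le _ (by simp)).trans ?_))
  rw [eLpNorm_congr_ae (Lp.coeFn_zero ℝ ∞ m0)]
  simp

lemma nuk_ac (k : ℕ) : nuk k ≪ m0 := Measure.restrict_le_self.absolutelyContinuous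

lemma le_sumNormE (p : ℝ≥0∞) (hp : 1 ≤ p) (k : ℕ) (f : ℝ →ₘ[m0] ℝ) :
    eLpNorm f p (nuk k) ≤ sumNormE p ∞ f := by
  unfold sumNormE
  refine le_iInf fun u => le_iInf fun v => le_iInf fun h => ?_
  have hu : AEStronglyMeasurable u (nuk k) := (Lp.aestronglyMeasurable u).mono_ac (nuk_ac k)
  have hv : AEStronglyMeasurable v (nuk k) := (Lp.aestronglyMeasurable v).mono_ac (nuk_ac k)
  have e : ⇑f =ᵐ[nuk k] ⇑u + ⇑v := by
    rw [h]; exact (nuk_ac k).ae_le (AEEqFun.coeFn_add _ _)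
  rw [eLpNorm_congr_ae e]
  refine (eLpNorm_add_le hu hv hp).trans ?_
  refine add_le_add ?_ ?_
  · exact eLpNorm_mono_measure _ Measure.restrict_le_self
  · exact (eLpNorm_le_eLpNorm_of_exponent_le le_top hv).trans
      (eLpNorm_mono_measure _ Measure.restrict_le_self)

lemma overlap (α C c : ℝ) (hα : α < 1) (hα0 : 0 ≤ α) (hC : 0 ≤ C) (hc : 0 < c) :
    ∃ D : ℝ, ∀ x : ℕ → ℝ, (∀ S : Finset ℕ, |∑ n ∈ S, x n| ≤ C * (S.card:ℝ)^α) →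
      ∀ N : ℕ, ∑ n ∈ Finset.range N, (if c ≤ |x n| then |x n| else 0) ≤ D := by
  refine ⟨2 * C * ((2*C/c)^(1/(1-α)))^α, fun x hx N => ?_⟩
  have habs : ∀ S : Finset ℕ, ∑ n ∈ S, |x n| ≤ 2 * C * (S.card:ℝ)^α := by
    intro S
    rw [← Finset.sum_filter_add_sum_filter_not S (fun n => 0 ≤ x n)]
    have b : ∀ P : ℕ → Prop, [DecidablePred P] →
        |∑ n ∈ S.filter P, x n| ≤ C * (S.card:ℝ)^α := by
      intro P _
      refine (hx _).trans ?_
      gcongr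
      exact Finset.filter_subset _ _
    have h1 : ∑ n ∈ S.filter (fun n => 0 ≤ x n), |x n|
        = ∑ n ∈ S.filter (fun n => 0 ≤ x n), x n :=
      Finset.sum_congr rfl fun n hn => abs_of_nonneg (Finset.mem_filter.1 hn).2
    have h2 : ∑ n ∈ S.filter (fun n => ¬ 0 ≤ x n), |x n|
        = -∑ n ∈ S.filter (fun n => ¬ 0 ≤ x n), x n := by
      rw [← Finset.sum_neg_distrib]
      exact Finset.sum_congr rfl fun n hn => abs_of_neg (not_le.1 (Finset.mem_filter.1 hn).2)
    rw [h1, h2]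
    have := (le_abs_self _).trans (b (fun n => 0 ≤ x n))
    have := (neg_le_abs _).trans (b (fun n => ¬ 0 ≤ x n))
    linarith
  rw [← Finset.sum_filter]
  set S := (Finset.range N).filter (fun n => c ≤ |x n|) with hS
  refine (habs S).trans ?_
  have hcard : c * S.card ≤ 2 * C * (S.card:ℝ)^α := by
    refine le_trans ?_ (habs S)
    have := Finset.card_nsmul_le_sum S (fun n => |x n|) c
      (fun n hn => (Finset.mem_filter.1 hn).2)
    simpa [mul_comm] using this
  have hM : (S.card:ℝ) ≤ (2*C/c)^(1/(1-α)) := by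
    rcases Nat.eq_zero_or_pos S.card with h0 | h0
    · rw [h0]; push_cast; positivity
    have hpos : (0:ℝ) < S.card := by exact_mod_cast h0
    have h1 : (S.card:ℝ)^(1-α) ≤ 2*C/c := by
      rw [le_div_iff₀ hc]
      have e : (S.card:ℝ) = (S.card:ℝ)^α * (S.card:ℝ)^(1-α) := by
        rw [← Real.rpow_add hpos]; simp
      have hp : 0 < (S.card:ℝ)^α := Real.rpow_pos_of_pos hpos _
      refine le_of_mul_le_mul_left ?_ hp
      calc (S.card:ℝ)^α * ((S.card:ℝ)^(1-α) * c) = c * S.card := by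
            rw [← mul_assoc, ← e, mul_comm]
        _ ≤ 2 * C * (S.card:ℝ)^α := hcard
        _ = _ := by ring
    have h2 := Real.rpow_le_rpow (by positivity) h1 (by exact one_div_nonneg.2 (by linarith) : 0 ≤ 1/(1-α))
    rwa [← Real.rpow_mul hpos.le, mul_one_div_cancel (by linarith), Real.rpow_one] at h2
  gcongr

theorem Lp_add_Linfty_not_isomorphic_Lp_inter_Linfty (p : ℝ≥0∞) (hp : 1 ≤ p) (hp' : p ≠ ∞) :
    ¬ SumInterIsomorphic p ∞ := by
  rintro ⟨T, C, hC0, hC, hT⟩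
  obtain ⟨α, hα, hα0, hcf⟩ := cf_upp p hp'
  set Cr := C.toReal with hCr
  have hCr0 : 0 < Cr := ENNReal.toReal_pos hC0.ne' hC.ne
  have hCC : C = ENNReal.ofReal Cr := (ENNReal.ofReal_toReal hC.ne).symm
  have hmem : ∀ k n, AEEqFun.mk (cf k n) (cf_meas k n).aestronglyMeasurable ∈ sumSpace p ∞ := by
    intro k n
    refine Submodule.mem_sup_right ?_
    change _ ∈ Lp ℝ ∞ m0
    rw [Lp.mem_Lp_iff_eLpNorm_lt_top, eLpNorm_congr_ae (AEEqFun.coeFn_mk _ _)]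
    refine lt_of_le_of_lt (eLpNorm_le_of_ae_bound (C := 1)
      (Filter.Eventually.of_forall fun t => cf_le k n t)) ?_
    simp
  let R : ℕ → ℕ → sumSpace p ∞ := fun k n => ⟨_, hmem k n⟩
  have hR : ∀ k n, ⇑(R k n : ℝ →ₘ[m0] ℝ) =ᵐ[m0] cf k n := fun k n => AEEqFun.coeFn_mk _ _
  let F : ℕ → ℕ → (ℝ →ₘ[m0] ℝ) := fun k n => (T (R k n) : ℝ →ₘ[m0] ℝ)
  -- upper bound for linear combinations
  have hup : ∀ (S : Finset ℕ) (θ : ℕ → ℝ) (k n : ℕ → ℕ),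
      interNormE p ∞ (∑ i ∈ S, θ i • F (k i) (n i)) ≤
        C * sumNormE p ∞ (∑ i ∈ S, θ i • (R (k i) (n i) : ℝ →ₘ[m0] ℝ)) := by
    intro S θ k n
    have := (hT (∑ i ∈ S, θ i • R (k i) (n i))).1
    simpa [map_sum, F] using this
  have hRs : ∀ (S : Finset ℕ) (θ : ℕ → ℝ) (k n : ℕ → ℕ),
      ⇑(∑ i ∈ S, θ i • (R (k i) (n i) : ℝ →ₘ[m0] ℝ)) =ᵐ[m0]
        fun t => ∑ i ∈ S, θ i * cf (k i) (n i) t := by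
    intro S θ k n
    have : ∀ᵐ t ∂m0, ∀ i, (R (k i) (n i) : ℝ →ₘ[m0] ℝ) t = cf (k i) (n i) t :=
      ae_all_iff.2 fun i => hR _ _
    filter_upwards [lc_coe S θ (fun i => (R (k i) (n i) : ℝ →ₘ[m0] ℝ)), this] with t h1 h2
    rw [h1]
    exact Finset.sum_congr rfl fun i _ => by rw [h2 i]
  -- Step 1
  have step1 : ∀ ε : ℝ≥0∞, ε ≠ 0 → ∃ k, ∀ n, eLpNorm (F k n) p m0 < ε := by
    intro ε hε
    by_contra! hcon
    choose n hn using hcon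
    obtain ⟨K, hK, h⟩ := cotype p hp hp' C ε hC.ne hε
    obtain ⟨i, hi, h⟩ := h m0 (fun i => F i (n i)) (fun i => AEEqFun.aestronglyMeasurable _) (by
      intro A
      rw [← eLpNorm_congr_ae (lc_coe (Finset.range K) (sg A) (fun i => F i (n i)))]
      refine (le_max_left _ _).trans ((hup _ (sg A) (fun i => i) n).trans ?_)
      refine (mul_le_mul_right (sumNormE_le_top p _) C).trans ?_
      rw [eLpNorm_congr_ae (hRs _ _ _ _)]
      have : eLpNorm (fun t => ∑ i ∈ Finset.range K, sg A i * cf i (n i) t) ∞ m0 ≤ 1 := by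
        refine (eLpNorm_le_of_ae_bound (C := 1)
          (Filter.Eventually.of_forall fun t => cf_diag_le K n (sg A) (abs_sg A) t)).trans ?_
        simp
      calc _ ≤ C * 1 := mul_le_mul_right this C
        _ = C := mul_one C)
    exact absurd h (not_lt.2 (hn i))
  -- Step 2
  have step2 : ∀ k, ∀ᵐ t ∂m0, ∀ S : Finset ℕ, |∑ n ∈ S, F k n t| ≤ Cr * (S.card:ℝ)^α := by
    intro k
    refine ae_all_iff.2 fun S => ?_
    have h1 := hup S (fun _ => 1) (fun _ => k) (fun n => n)
    have h2 := (le_max_right _ _).trans (h1.trans (mul_le_mul_right (sumNormE_le_p p _) C))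
    rw [eLpNorm_congr_ae (hRs S (fun _ => 1) (fun _ => k) (fun n => n)),
      eLpNorm_congr_ae (lc_coe S (fun _ => 1) (fun n => F k n))] at h2
    simp only [one_mul] at h2
    have h3 := h2.trans (mul_le_mul_right (hcf k S) C)
    rw [hCC, ← ENNReal.ofReal_mul hCr0.le, eLpNorm_exponent_top] at h3
    filter_upwards [ae_le_eLpNormEssSup (f := fun t => ∑ n ∈ S, F k n t) (μ := m0)] with t ht
    have := ht.trans h3
    rw [Real.enorm_eq_ofReal_abs] at this
    exact (ENNReal.ofReal_le_ofReal_iff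
      (mul_nonneg hCr0.le (Real.rpow_nonneg (Nat.cast_nonneg _) _))).1 this
  set c : ℝ := 1 / (4 * Cr) with hc
  have hc0 : 0 < c := by positivity
  have hCc : C * ENNReal.ofReal c = 1/4 := by
    rw [hCC, ← ENNReal.ofReal_mul hCr0.le, hc]
    have : Cr * (1 / (4 * Cr)) = 1/4 := by field_simp
    rw [this, ENNReal.ofReal_div_of_pos (by norm_num), ENNReal.ofReal_one, ENNReal.ofReal_ofNat]
  obtain ⟨D, hD⟩ := overlap α Cr c hα hα0 hCr0.le hc0
  obtain ⟨N, hN0, hN⟩ := cotype p hp hp' (C * max (ENNReal.ofReal D) 1) (1/4)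
    (ENNReal.mul_ne_top hC.ne (by simp)) (by simp)
  have hNN : (N : ℝ≥0∞) ≠ 0 := by exact_mod_cast hN0.ne'
  obtain ⟨k, hk⟩ := step1 (min (ENNReal.ofReal c) (1/N)) (by
    refine (lt_min ?_ ?_).ne'
    · simpa using hc0
    · simp)
  let E : ℕ → Set ℝ := fun n => {t | c ≤ |F k n t|}
  have hE : ∀ n, MeasurableSet (E n) := fun n =>
    measurableSet_le measurable_const (by have := (F k n).measurable; fun_prop)
  let G : ℕ → ℝ → ℝ := fun n => (E n).indicator (F k n)
  have hG : ∀ n, AEStronglyMeasurable (G n) m0 := fun n =>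
    (AEEqFun.aestronglyMeasurable _).indicator (hE n)
  have hXm : ∀ n, AEEqFun.mk (G n) (hG n) ∈ interSpace p ∞ := by
    intro n
    have hF : F k n ∈ interSpace p ∞ := (T (R k n)).2
    constructor
    · have h : F k n ∈ Lp ℝ p m0 := hF.1
      change _ ∈ Lp ℝ p m0
      rw [Lp.mem_Lp_iff_eLpNorm_lt_top] at h ⊢
      rw [eLpNorm_congr_ae (AEEqFun.coeFn_mk _ _)]
      exact (eLpNorm_indicator_le _).trans_lt h
    · have h : F k n ∈ Lp ℝ ∞ m0 := hF.2
      change _ ∈ Lp ℝ ∞ m0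
      rw [Lp.mem_Lp_iff_eLpNorm_lt_top] at h ⊢
      rw [eLpNorm_congr_ae (AEEqFun.coeFn_mk _ _)]
      exact (eLpNorm_indicator_le _).trans_lt h
  let X : ℕ → interSpace p ∞ := fun n => ⟨_, hXm n⟩
  have hX : ∀ n, ⇑(X n : ℝ →ₘ[m0] ℝ) =ᵐ[m0] G n := fun n => AEEqFun.coeFn_mk _ _
  let y : ℕ → sumSpace p ∞ := fun n => T.symm (X n)
  have hmeas : ∀ f : ℝ →ₘ[m0] ℝ, AEStronglyMeasurable f (nuk k) := fun f =>
    (AEEqFun.aestronglyMeasurable f).mono_ac (nuk_ac k)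
  obtain ⟨n, hn, hlt⟩ := hN (nuk k) (fun n => (y n : ℝ →ₘ[m0] ℝ)) (fun n => hmeas _) (by
    intro A
    rw [← eLpNorm_congr_ae ((nuk_ac k).ae_le
      (lc_coe (Finset.range N) (sg A) (fun n => (y n : ℝ →ₘ[m0] ℝ))))]
    refine (le_sumNormE p hp k _).trans ?_
    have h1 := (hT (∑ i ∈ Finset.range N, sg A i • y i)).2
    have h2 : sumNormE p ∞ (∑ i ∈ Finset.range N, sg A i • (y i : ℝ →ₘ[m0] ℝ)) ≤
        C * interNormE p ∞ (∑ i ∈ Finset.range N, sg A i • (X i : ℝ →ₘ[m0] ℝ)) := by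
      simpa [map_sum, y] using h1
    refine h2.trans (mul_le_mul_right ?_ C)
    have hXs : ⇑(∑ i ∈ Finset.range N, sg A i • (X i : ℝ →ₘ[m0] ℝ)) =ᵐ[m0]
        fun t => ∑ i ∈ Finset.range N, sg A i * G i t := by
      have : ∀ᵐ t ∂m0, ∀ i, (X i : ℝ →ₘ[m0] ℝ) t = G i t := ae_all_iff.2 fun i => hX i
      filter_upwards [lc_coe (Finset.range N) (sg A) (fun i => (X i : ℝ →ₘ[m0] ℝ)), this]
        with t h1 h2
      rw [h1]
      exact Finset.sum_congr rfl fun i _ => by rw [h2 i]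
    unfold interNormE
    rw [eLpNorm_congr_ae hXs, eLpNorm_congr_ae hXs, max_comm]
    refine max_le_max ?_ ?_
    · have hb : ∀ᵐ t ∂m0, ‖∑ i ∈ Finset.range N, sg A i * G i t‖ ≤ D := by
        filter_upwards [step2 k] with t ht
        rw [Real.norm_eq_abs]
        refine (Finset.abs_sum_le_sum_abs _ _).trans (le_trans (le_of_eq ?_)
          (hD (fun n => F k n t) ht N))
        refine Finset.sum_congr rfl fun i _ => ?_
        rw [abs_mul, abs_sg, one_mul]
        by_cases h : c ≤ |F k i t|
        · have : t ∈ E i := h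
          simp [G, this, h]
        · have : t ∉ E i := h
          simp [G, this, h]
      refine (eLpNorm_le_of_ae_bound hb).trans ?_
      simp
    · have e : (fun t => ∑ i ∈ Finset.range N, sg A i * G i t)
          = ∑ i ∈ Finset.range N, sg A i • G i := by
        ext t; simp
      rw [e]
      refine (eLpNorm_sum_le (fun i _ => (hG i).const_smul _) hp).trans ?_
      calc _ ≤ ∑ i ∈ Finset.range N, (1/N : ℝ≥0∞) := by
            refine Finset.sum_le_sum fun i _ => ?_
            rw [eLpNorm_const_smul]
            have : ‖sg A i‖ₑ = 1 := by rw [Real.enorm_eq_ofReal_abs, abs_sg]; simp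
            rw [this, one_mul]
            exact (eLpNorm_indicator_le _).trans ((hk i).le.trans (min_le_right _ _))
        _ = 1 := by
            simp only [Finset.sum_const, Finset.card_range, nsmul_eq_mul, one_div]
            exact ENNReal.mul_inv_cancel hNN (by simp))
  -- lower bound
  have hdiff : eLpNorm ((R k n - y n : sumSpace p ∞) : ℝ →ₘ[m0] ℝ) p (nuk k) ≤ 1/4 := by
    refine (le_sumNormE p hp k _).trans ((hT (R k n - y n)).2.trans ?_)
    rw [← hCc]
    refine mul_le_mul_right ?_ C
    have e : ⇑((T (R k n - y n) : interSpace p ∞) : ℝ →ₘ[m0] ℝ) =ᵐ[m0]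
        (E n)ᶜ.indicator (F k n) := by
      have e1 : ((T (R k n - y n) : interSpace p ∞) : ℝ →ₘ[m0] ℝ)
          = F k n - (X n : ℝ →ₘ[m0] ℝ) := by simp [F, y]
      rw [e1]
      filter_upwards [AEEqFun.coeFn_sub (F k n) (X n : ℝ →ₘ[m0] ℝ), hX n] with t h1 h2
      rw [h1, Pi.sub_apply, h2]
      by_cases h : t ∈ E n <;> simp [G, h]
    unfold interNormE
    rw [eLpNorm_congr_ae e, eLpNorm_congr_ae e]
    refine max_le ?_ ?_
    · exact (eLpNorm_indicator_le _).trans ((hk n).le.trans (min_le_left _ _))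
    · refine (eLpNorm_le_of_ae_bound (C := c) (Filter.Eventually.of_forall fun t => ?_)).trans ?_
      · by_cases h : t ∈ E n
        · simp [h, hc0.le]
        · have : |F k n t| < c := not_le.1 h
          simp [h, this.le]
      · simp
  have hlow := cf_low p hp k n
  have e : cf k n =ᵐ[nuk k] ⇑(y n : ℝ →ₘ[m0] ℝ)
      + ⇑((R k n - y n : sumSpace p ∞) : ℝ →ₘ[m0] ℝ) := by
    have h2 := AEEqFun.coeFn_sub (R k n : ℝ →ₘ[m0] ℝ) (y n : ℝ →ₘ[m0] ℝ)
    refine (nuk_ac k).ae_le ?_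
    filter_upwards [h2, hR k n] with t h2 h3
    rw [Pi.add_apply, Submodule.coe_sub, h2, Pi.sub_apply, h3]; ring
  rw [eLpNorm_congr_ae e] at hlow
  have h5 := hlow.trans ((eLpNorm_add_le (hmeas _) (hmeas _) hp).trans (add_le_add_right hdiff _))
  have h6 : eLpNorm (y n : ℝ →ₘ[m0] ℝ) p (nuk k) + 1/4 < 1/4 + 1/4 :=
    ENNReal.add_lt_add_right (by simp) hlt
  have h7 : (1/4 : ℝ≥0∞) + 1/4 = 1/2 := by
    rw [← ENNReal.toReal_eq_toReal_iff' (by simp) (by simp), ENNReal.toReal_add (by simp) (by simp)]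
    simp; norm_num
  rw [h7] at h6
  exact absurd h5 (not_le.2 h6)
end
end

section
/- Let {α_k}_{k=1}^∞ be a sequence of functions in L_2(0, ∞) with pairwise disjoint supports such that ‖α_k‖_{L_2} = 1 for every k and the union of the supports of the α_k has Lebesgue measure at most 1. Then for every finitely supported sequence of real scalars (a_k), one has ‖∑_k a_k α_k‖_{L_2+L_∞} = (∑_k a_k^2)^{1/2}; that is, {α_k} is isometrically equivalent in L_2 + L_∞ to the unit vector basis of ℓ_2. -/
open MeasureTheory ENNReal

noncomputable section

/-- The norm of the space `L_p + L_q` on `(0, ∞)`: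
`‖x‖ = inf { ‖u‖_p + ‖v‖_q : x = u + v, u ∈ L_p, v ∈ L_q }`
(with value `∞` when `x ∉ L_p + L_q`). -/
def sumNormF (p q : ℝ≥0∞) (x : ℝ → ℝ) : ℝ≥0∞ :=
  ⨅ (u : ℝ → ℝ) (v : ℝ → ℝ) (_ : MemLp u p m0) (_ : MemLp v q m0) (_ : x = u + v),
    eLpNorm u p m0 + eLpNorm v q m0

theorem aux_sq_sum (α : ℕ → ℝ → ℝ)
    (hdisj : Pairwise fun j k => Disjoint (Function.support (α j)) (Function.support (α k)))
    (s : Finset ℕ) (a : ℕ → ℝ) (t : ℝ) :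
    (∑ k ∈ s, a k * α k t) ^ 2 = ∑ k ∈ s, (a k) ^ 2 * (α k t) ^ 2 := by
  by_cases h : ∃ j ∈ s, α j t ≠ 0
  · obtain ⟨j, hj, hjt⟩ := h
    have hz : ∀ k, k ≠ j → α k t = 0 := by
      intro k hk
      by_contra hne
      exact Set.disjoint_left.1 (hdisj hk) hne hjt
    rw [Finset.sum_eq_single_of_mem j hj, Finset.sum_eq_single_of_mem j hj]
    · ring
    · intro k _ hk
      simp [hz k hk]
    · intro k _ hk
      simp [hz k hk]
  · push Not at h
    rw [Finset.sum_eq_zero, Finset.sum_eq_zero]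
    · simp
    · intro k hk
      simp [h k hk]
    · intro k hk
      simp [h k hk]

theorem aux_eLpNorm_sq (f : ℝ → ℝ) :
    eLpNorm f 2 m0 ^ 2 = ∫⁻ t, ENNReal.ofReal ((f t) ^ 2) ∂m0 := by
  have h := eLpNorm_nnreal_pow_eq_lintegral (μ := m0) (f := f) (p := 2) (by norm_num)
  have h2 : eLpNorm f 2 m0 ^ 2 = ∫⁻ t, ‖f t‖ₑ ^ 2 ∂m0 := by
    simpa using h
  rw [h2]
  refine lintegral_congr fun t => ?_
  rw [← sq_abs, ENNReal.ofReal_pow (abs_nonneg _), ← Real.enorm_eq_ofReal_abs]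

theorem aux_norm (α : ℕ → ℝ → ℝ)
    (hmem : ∀ k, MemLp (α k) 2 m0)
    (hdisj : Pairwise fun j k => Disjoint (Function.support (α j)) (Function.support (α k)))
    (hnorm : ∀ k, eLpNorm (α k) 2 m0 = 1)
    (s : Finset ℕ) (a : ℕ → ℝ) :
    eLpNorm (∑ k ∈ s, a k • α k) 2 m0 = ENNReal.ofReal (Real.sqrt (∑ k ∈ s, (a k) ^ 2)) := by
  have hsq : eLpNorm (∑ k ∈ s, a k • α k) 2 m0 ^ 2
      = ENNReal.ofReal (Real.sqrt (∑ k ∈ s, (a k) ^ 2)) ^ 2 := by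
    rw [← ENNReal.ofReal_pow (Real.sqrt_nonneg _),
      Real.sq_sqrt (Finset.sum_nonneg fun k _ => sq_nonneg _), aux_eLpNorm_sq]
    have h1 : ∀ t, ENNReal.ofReal (((∑ k ∈ s, a k • α k) t) ^ 2)
        = ∑ k ∈ s, ENNReal.ofReal ((a k) ^ 2) * ENNReal.ofReal ((α k t) ^ 2) := by
      intro t
      have : (∑ k ∈ s, a k • α k) t = ∑ k ∈ s, a k * α k t := by
        simp [Finset.sum_apply]
      rw [this, aux_sq_sum α hdisj, ENNReal.ofReal_sum_of_nonneg (fun k _ => by positivity)]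
      exact Finset.sum_congr rfl fun k _ => ENNReal.ofReal_mul (sq_nonneg _)
    simp_rw [h1]
    have hm : ∀ k, AEMeasurable (fun t => ENNReal.ofReal ((α k t) ^ 2)) m0 := fun k =>
      ((hmem k).1.aemeasurable.pow_const 2).ennreal_ofReal
    rw [lintegral_finsetSum' _ (fun k _ => (hm k).const_mul _),
      ENNReal.ofReal_sum_of_nonneg (fun k _ => sq_nonneg _)]
    refine Finset.sum_congr rfl fun k _ => ?_
    rw [lintegral_const_mul'' _ (hm k), ← aux_eLpNorm_sq, hnorm k]
    simp
  exact (ENNReal.pow_right_strictMono two_ne_zero).injective hsq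

/-- **Statement 9.** If `{α_k}` are functions in `L_2(0, ∞)` with pairwise disjoint supports,
`‖α_k‖_{L_2} = 1` for every `k`, and the union of their supports has measure at most `1`, then
for every finitely supported sequence of scalars `(a_k)` one has
`‖∑ a_k α_k‖_{L_2+L_∞} = (∑ a_k²)^{1/2}`, i.e. `{α_k}` is isometrically equivalent in
`L_2 + L_∞` to the unit vector basis of `ℓ_2`. -/
theorem sumNorm_disjoint_sequence_isometric_l2 (α : ℕ → ℝ → ℝ)
    (hmem : ∀ k, MemLp (α k) 2 m0)
    (hdisj : Pairwise fun j k => Disjoint (Function.support (α j)) (Function.support (α k)))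
    (hnorm : ∀ k, eLpNorm (α k) 2 m0 = 1)
    (hsupp : m0 (⋃ k, Function.support (α k)) ≤ 1) :
    ∀ (s : Finset ℕ) (a : ℕ → ℝ),
      sumNormF 2 ∞ (∑ k ∈ s, a k • α k) =
        ENNReal.ofReal (Real.sqrt (∑ k ∈ s, (a k) ^ 2)) := by
  intro s a
  have hN := aux_norm α hmem hdisj hnorm s a
  have hx : MemLp (∑ k ∈ s, a k • α k) 2 m0 :=
    memLp_finset_sum' s fun k _ => (hmem k).const_smul (a k)
  rw [← hN]
  apply le_antisymm
  · unfold sumNormF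
    refine iInf_le_of_le (∑ k ∈ s, a k • α k) (iInf_le_of_le 0 (iInf_le_of_le hx
      (iInf_le_of_le MemLp.zero (iInf_le_of_le (by simp) ?_))))
    simp
  · unfold sumNormF
    refine le_iInf fun u => le_iInf fun v => le_iInf fun hu => le_iInf fun hv => le_iInf fun h => ?_
    set S := toMeasurable m0 (⋃ k, Function.support (α k)) with hS
    have hSm : MeasurableSet S := measurableSet_toMeasurable _ _
    have hS1 : m0 S ≤ 1 := by rw [hS, measure_toMeasurable]; exact hsupp
    have hsub : Function.support (∑ k ∈ s, a k • α k) ⊆ S := by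
      intro t ht
      apply subset_toMeasurable
      by_contra hn
      apply ht
      rw [Finset.sum_apply]
      refine Finset.sum_eq_zero fun k _ => ?_
      have : α k t = 0 := by
        by_contra h0
        exact hn (Set.mem_iUnion.2 ⟨k, h0⟩)
      simp [this]
    rw [← eLpNorm_restrict_eq_of_support_subset hsub, h]
    refine (eLpNorm_add_le hu.1.restrict hv.1.restrict (by norm_num)).trans ?_
    refine add_le_add (eLpNorm_mono_measure _ Measure.restrict_le_self) ?_
    refine (eLpNorm_le_eLpNorm_mul_rpow_measure_univ (q := ∞) le_top hv.1.restrict).trans ?_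
    refine (mul_le_mul' (eLpNorm_mono_measure _ Measure.restrict_le_self)
      (ENNReal.rpow_le_one (by simpa using hS1) (by norm_num))).trans (by simp)
end
end
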